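/- arXiv:math/0412428 — 3 statements merged into one kernel-verified Lean document; each statement's English description precedes it below -/
import Mathlib

section
/- Let β : (ℤ₊)^d → (0,∞) be nondecreasing with β(n) ≤ (3d log log |n|)^{1/2} for all n with |n| ≥ e^e, and set c(t) = β(⌊exp(t)⌋) for t ∈ [0,∞)^d. If J_0 = Σ_{n ∈ (ℤ₊)^d} |n|^{-1} β(n)^{2d−1} e^{−β(n)²/2} < ∞, then Σ_{k ∈ (ℤ_{≥0})^d} c(k)^{2d−1} e^{−c(k)²/2} < ∞. -/
open Filter Real

/-- The weight `x ^ p * exp (-x ^ 2 / 2)` is decreasing on `[b, ∞)` up to a constant factor. -/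
lemma pow_mul_exp_neg_sq_le (p : ℕ) {b x y : ℝ} (hb : 0 < b) (hbx : b ≤ x) (hxy : x ≤ y) :
    y ^ p * exp (-y ^ 2 / 2) ≤
      (2 / b ^ 2) ^ p * p.factorial * exp (b ^ 2 / 2) * (x ^ p * exp (-x ^ 2 / 2)) := by
  have hx : 0 < x := hb.trans_le hbx
  have hy : 0 < y := hx.trans_le hxy
  set v := (b ^ 2 + (y ^ 2 - x ^ 2)) / 2 with hv
  have hsq : b ^ 2 ≤ x ^ 2 := by gcongr
  have hsq' : x ^ 2 ≤ y ^ 2 := by gcongr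
  have hb2 : 0 < b ^ 2 := by positivity
  have hv0 : 0 ≤ v := by rw [hv]; linarith
  have hvp : v ^ p ≤ p.factorial * exp v := by
    have h := Real.pow_div_factorial_le_exp v hv0 p
    rwa [div_le_iff₀ (by positivity), mul_comm] at h
  have hyx : y ≤ 2 / b ^ 2 * v * x := by
    rw [hv, div_mul_eq_mul_div, div_mul_eq_mul_div, le_div_iff₀ hb2]
    nlinarith [mul_nonneg (sub_nonneg.2 hsq) (sub_nonneg.2 hxy),
      mul_nonneg (mul_nonneg hx.le hy.le) (sub_nonneg.2 hxy)]
  have hexp : exp v * exp (-y ^ 2 / 2) = exp (b ^ 2 / 2) * exp (-x ^ 2 / 2) := by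
    rw [← exp_add, ← exp_add, hv]
    ring_nf
  calc y ^ p * exp (-y ^ 2 / 2)
      ≤ (2 / b ^ 2 * v * x) ^ p * exp (-y ^ 2 / 2) := by gcongr
    _ = (2 / b ^ 2) ^ p * x ^ p * exp (-y ^ 2 / 2) * v ^ p := by rw [mul_pow, mul_pow]; ring
    _ ≤ (2 / b ^ 2) ^ p * x ^ p * exp (-y ^ 2 / 2) * (p.factorial * exp v) := by gcongr
    _ = (2 / b ^ 2) ^ p * x ^ p * p.factorial * (exp v * exp (-y ^ 2 / 2)) := by ring
    _ = _ := by rw [hexp]; ring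

/-- The endpoints of the blocks `(expFloor j, expFloor (j + 1)]` partitioning the positive
integers: `0`, followed by `⌊exp j⌋` for `j = 0, 1, 2, …`. -/
noncomputable def expFloor : ℕ → ℕ
  | 0 => 0
  | j + 1 => ⌊exp (j : ℝ)⌋₊

lemma expFloor_succ_pos (j : ℕ) : 0 < expFloor (j + 1) :=
  Nat.floor_pos.2 (one_le_exp (Nat.cast_nonneg j))

lemma two_mul_expFloor_le (j : ℕ) : 2 * expFloor j ≤ expFloor (j + 1) := by
  cases j with
  | zero => simp [expFloor]
  | succ j =>
    refine Nat.le_floor ?_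
    have h1 : (expFloor (j + 1) : ℝ) ≤ exp (j : ℝ) := Nat.floor_le (exp_pos _).le
    have h2 : (2 : ℝ) ≤ exp 1 := by linarith [add_one_le_exp (1 : ℝ)]
    push_cast
    rw [exp_add, mul_comm]
    exact mul_le_mul h1 h2 zero_le_two (exp_pos _).le

lemma expFloor_monotone : Monotone expFloor :=
  monotone_nat_of_le_succ fun j => by linarith [two_mul_expFloor_le j, Nat.zero_le (expFloor j)]

lemma half_le_sum_inv_expFloor (j : ℕ) :
    (1 / 2 : ℝ) ≤ ∑ m ∈ Finset.Ioc (expFloor j) (expFloor (j + 1)), (m : ℝ)⁻¹ := by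
  have hpos : (0 : ℝ) < expFloor (j + 1) := by exact_mod_cast expFloor_succ_pos j
  have h2 : (2 : ℝ) * expFloor j ≤ expFloor (j + 1) := by exact_mod_cast two_mul_expFloor_le j
  calc (1 / 2 : ℝ)
      ≤ ((expFloor (j + 1) : ℝ) - expFloor j) * (expFloor (j + 1) : ℝ)⁻¹ := by
        rw [← div_eq_mul_inv, le_div_iff₀ hpos]; linarith
    _ = ∑ _m ∈ Finset.Ioc (expFloor j) (expFloor (j + 1)), (expFloor (j + 1) : ℝ)⁻¹ := by
        rw [Finset.sum_const, Nat.card_Ioc, nsmul_eq_mul,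
          Nat.cast_sub (expFloor_monotone j.le_succ)]
    _ ≤ _ := by
        refine Finset.sum_le_sum fun m hm => ?_
        rw [Finset.mem_Ioc] at hm
        have : 0 < m := by omega
        gcongr
        exact hm.2

/-- The box of multi-indices whose `i`-th coordinate lies in the `k i`-th block. -/
noncomputable def expBox {d : ℕ} (k : Fin d → ℕ) : Finset (Fin d → ℕ) :=
  Fintype.piFinset fun i => Finset.Ioc (expFloor (k i)) (expFloor (k i + 1))

lemma mem_expBox {d : ℕ} {k n : Fin d → ℕ} :
    n ∈ expBox k ↔ ∀ i, expFloor (k i) < n i ∧ n i ≤ expFloor (k i + 1) := by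
  simp [expBox]

lemma one_le_of_mem_expBox {d : ℕ} {k n : Fin d → ℕ} (h : n ∈ expBox k) : 1 ≤ n :=
  fun i => Nat.one_le_of_lt (mem_expBox.1 h i).1

lemma eq_of_mem_expBox {d : ℕ} {k l n : Fin d → ℕ} (hk : n ∈ expBox k) (hl : n ∈ expBox l) :
    k = l := by
  funext i
  obtain ⟨h1, h2⟩ := mem_expBox.1 hk i
  obtain ⟨h3, h4⟩ := mem_expBox.1 hl i
  have h5 := expFloor_monotone.reflect_lt (h1.trans_le h4)
  have h6 := expFloor_monotone.reflect_lt (h3.trans_le h2)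
  omega

lemma half_pow_le_sum_expBox {d : ℕ} (k : Fin d → ℕ) :
    (1 / 2 : ℝ) ^ d ≤ ∑ n ∈ expBox k, (∏ i, (n i : ℝ))⁻¹ := by
  simp_rw [← Finset.prod_inv_distrib]
  rw [expBox, ← Finset.prod_univ_sum (fun i => Finset.Ioc (expFloor (k i)) (expFloor (k i + 1)))
    (fun _ m => (m : ℝ)⁻¹)]
  calc (1 / 2 : ℝ) ^ d = ∏ _i : Fin d, (1 / 2 : ℝ) := by simp
    _ ≤ _ := Finset.prod_le_prod (fun _ _ => by norm_num)
        fun i _ => half_le_sum_inv_expFloor (k i)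

lemma summable_sum_expBox {d : ℕ} {g : (Fin d → ℕ) → ℝ}
    (hg : Summable fun n : {n : Fin d → ℕ // (1 : Fin d → ℕ) ≤ n} => g n.1) :
    Summable fun k : Fin d → ℕ => ∑ n ∈ expBox k, g n := by
  let e : (Σ k : Fin d → ℕ, {n // n ∈ expBox k}) → {n : Fin d → ℕ // (1 : Fin d → ℕ) ≤ n} :=
    fun s => ⟨s.2.1, one_le_of_mem_expBox s.2.2⟩
  have he : Function.Injective e := by
    rintro ⟨k, n, hn⟩ ⟨l, m, hm⟩ h
    obtain rfl : n = m := congrArg Subtype.val h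
    obtain rfl := eq_of_mem_expBox hn hm
    rfl
  refine (hg.comp_injective he).sigma.congr fun k => ?_
  rw [tsum_fintype]
  exact Finset.sum_coe_sort (expBox k) g

/-- if `β : (ℤ₊)^d → (0,∞)` is nondecreasing, bounded by
`(3d log log |n|)^{1/2}` for `|n| ≥ e^e`, and
`J₀ = Σ_n |n|⁻¹ β(n)^{2d-1} e^{-β(n)²/2} < ∞`, then, with `c(t) = β(⌊exp t⌋)`,
`Σ_{k ∈ (ℤ≥0)^d} c(k)^{2d-1} e^{-c(k)²/2} < ∞`. -/
theorem sum_over_lattice_of_J0_summable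
    (d : ℕ) (hd : 1 ≤ d)
    (β : (Fin d → ℕ) → ℝ)
    (hpos : ∀ n : Fin d → ℕ, (1 : Fin d → ℕ) ≤ n → 0 < β n)
    (hmono : ∀ m n : Fin d → ℕ, (1 : Fin d → ℕ) ≤ m → m ≤ n → β m ≤ β n)
    (hbdd : ∀ n : Fin d → ℕ, (1 : Fin d → ℕ) ≤ n →
      Real.exp (Real.exp 1) ≤ ∏ i, (n i : ℝ) →
      β n ≤ Real.sqrt (3 * d * Real.log (Real.log (∏ i, (n i : ℝ)))))
    (hJ0 : Summable (fun n : {n : Fin d → ℕ // (1 : Fin d → ℕ) ≤ n} =>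
      (∏ i, (n.1 i : ℝ))⁻¹ * β n.1 ^ (2 * d - 1) * Real.exp (-(β n.1) ^ 2 / 2))) :
    Summable (fun k : Fin d → ℕ =>
      (β fun i => ⌊Real.exp (k i : ℝ)⌋₊) ^ (2 * d - 1) *
        Real.exp (-(β fun i => ⌊Real.exp (k i : ℝ)⌋₊) ^ 2 / 2)) := by
  have hone := hpos 1 le_rfl
  set C : ℝ := (2 / β 1 ^ 2) ^ (2 * d - 1) * (2 * d - 1).factorial * exp (β 1 ^ 2 / 2)
  have hC0 : 0 ≤ C := by positivity
  have hc : ∀ k : Fin d → ℕ, 1 ≤ fun i => ⌊exp (k i : ℝ)⌋₊ :=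
    fun k i => expFloor_succ_pos (k i)
  refine Summable.of_nonneg_of_le
    (fun k => mul_nonneg (pow_nonneg (hpos _ (hc k)).le _) (exp_pos _).le) (fun k => ?_)
    ((summable_sum_expBox (g := fun n => (∏ i, (n i : ℝ))⁻¹ * β n ^ (2 * d - 1) *
      exp (-(β n) ^ 2 / 2)) hJ0).mul_left (2 ^ d * C))
  set y := β fun i => ⌊exp (k i : ℝ)⌋₊
  have hy0 : 0 < y := hpos _ (hc k)
  calc y ^ (2 * d - 1) * exp (-y ^ 2 / 2)
      = 2 ^ d * ((1 / 2 : ℝ) ^ d * (y ^ (2 * d - 1) * exp (-y ^ 2 / 2))) := by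
        rw [← mul_assoc, ← mul_pow]; norm_num
    _ ≤ 2 ^ d * ((∑ n ∈ expBox k, (∏ i, (n i : ℝ))⁻¹) *
          (y ^ (2 * d - 1) * exp (-y ^ 2 / 2))) := by
        gcongr
        exact half_pow_le_sum_expBox k
    _ ≤ 2 ^ d * (C * ∑ n ∈ expBox k, (∏ i, (n i : ℝ))⁻¹ * β n ^ (2 * d - 1) *
          exp (-(β n) ^ 2 / 2)) := by
        refine mul_le_mul_of_nonneg_left ?_ (by positivity)
        rw [Finset.sum_mul, Finset.mul_sum]
        refine Finset.sum_le_sum fun n hn => ?_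
        have hn1 := one_le_of_mem_expBox hn
        have hny : β n ≤ y := hmono _ _ hn1 fun i => (mem_expBox.1 hn i).2
        calc (∏ i, (n i : ℝ))⁻¹ * (y ^ (2 * d - 1) * exp (-y ^ 2 / 2))
            ≤ (∏ i, (n i : ℝ))⁻¹ * (C * (β n ^ (2 * d - 1) * exp (-(β n) ^ 2 / 2))) := by
              refine mul_le_mul_of_nonneg_left ?_ (by positivity)
              exact pow_mul_exp_neg_sq_le _ hone (hmono _ _ le_rfl hn1) hny
          _ = _ := by ring
    _ = _ := by ring
end

section
/- Define the sequence (w_j) by w_1 = 2 and w_{j+1} = w_j + log w_j for j ≥ 1. Then w_j ∼ j log j as j → ∞, i.e. lim_{j→∞} w_j / (j log j) = 1. -/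
open Filter Real

/-- One step `a ↦ a + log a` increases `x / log x` by `1 + O(1 / log (a + log a))`. -/
lemma div_log_step_bounds {a : ℝ} (ha : 1 < a) :
    1 - 2 / log (a + log a) ≤ (a + log a) / log (a + log a) - a / log a ∧
      (a + log a) / log (a + log a) - a / log a ≤ 1 := by
  have ha0 : 0 < a := by linarith
  have hL : 0 < log a := log_pos ha
  have hLa : log a ≤ a := by linarith [log_le_sub_one_of_pos ha0]
  have hlt : log a < log (a + log a) := log_lt_log ha0 (by linarith)
  have hδ : a * (log (a + log a) - log a) ≤ log a := by
    rw [← log_div (by linarith) ha0.ne']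
    have h := log_le_sub_one_of_pos (show 0 < (a + log a) / a by positivity)
    calc a * log ((a + log a) / a) ≤ a * ((a + log a) / a - 1) := by gcongr
      _ = log a := by field_simp; ring
  generalize log (a + log a) = M at *
  generalize log a = L at *
  have hM : 0 < M := hL.trans hlt
  have hδ1 : M - L ≤ 1 := by nlinarith
  have key : (a + L) / M - a / L = 1 - ((M - L) / M + a * (M - L) / (L * M)) := by
    field_simp
    ring
  have h1 : (M - L) / M ≤ 1 / M := by gcongr
  have h2 : a * (M - L) / (L * M) ≤ 1 / M := by
    rw [div_le_div_iff₀ (by positivity) hM]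
    nlinarith
  have h3 : 0 ≤ (M - L) / M := div_nonneg (by linarith) hM.le
  have h4 : 0 ≤ a * (M - L) / (L * M) :=
    div_nonneg (mul_nonneg ha0.le (by linarith)) (by positivity)
  have h5 : 2 / M = 1 / M + 1 / M := by ring
  rw [key, h5]
  constructor <;> linarith

/-- If `x n / (n log (x n)) → 1` and `x n → ∞`, then `x n ∼ n log n`. -/
lemma tendsto_div_mul_log_of_tendsto_div_log {x : ℕ → ℝ} (hx : Tendsto x atTop atTop)
    (h : Tendsto (fun n : ℕ => x n / log (x n) / n) atTop (nhds 1)) :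
    Tendsto (fun n : ℕ => x n / ((n : ℝ) * log n)) atTop (nhds 1) := by
  have hL : Tendsto (fun n => log (x n)) atTop atTop := tendsto_log_atTop.comp hx
  have hlog : Tendsto (fun n : ℕ => log (x n / log (x n) / n) / log (x n)) atTop (nhds 0) :=
    (h.log one_ne_zero).div_atTop hL
  have hloglog : Tendsto (fun n : ℕ => log (log (x n)) / log (x n)) atTop (nhds 0) :=
    isLittleO_log_id_atTop.tendsto_div_nhds_zero.comp hL
  have hratio : Tendsto (fun n : ℕ => log n / log (x n)) atTop (nhds 1) := by
    have := (hlog.add hloglog).const_sub 1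
    rw [add_zero, sub_zero] at this
    refine this.congr' ?_
    filter_upwards [hx.eventually_gt_atTop 0, hL.eventually_gt_atTop 0, eventually_gt_atTop 0]
      with n hxn hLn hn
    have hn' : (n : ℝ) ≠ 0 := by positivity
    rw [log_div (by positivity) hn', log_div hxn.ne' hLn.ne']
    field_simp
    ring
  have := h.div hratio one_ne_zero
  rw [div_one] at this
  refine this.congr' ?_
  filter_upwards [hL.eventually_gt_atTop 0, eventually_gt_atTop 1] with n hLn hn
  have hlogn : 0 < log (n : ℝ) := log_pos (by exact_mod_cast hn)
  have hn' : (0 : ℝ) < n := by positivity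
  simp only [Pi.div_apply]
  field_simp

/-- Let `w 1 = 2` and `w (j+1) = w j + log (w j)` for `j ≥ 1`.
Then `w j ∼ j log j` as `j → ∞`, i.e. `w j / (j * log j) → 1`. -/
theorem wj_asymptotic (w : ℕ → ℝ)
    (h1 : w 1 = 2)
    (hrec : ∀ j : ℕ, 1 ≤ j → w (j + 1) = w j + Real.log (w j)) :
    Tendsto (fun j : ℕ => w j / ((j : ℝ) * Real.log j)) atTop (nhds 1) := by
  have hlog2 : 0 < log 2 := log_pos one_lt_two
  have hlower : ∀ j : ℕ, 1 ≤ j → 2 ≤ w j ∧ j * log 2 ≤ w j := by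
    intro j hj
    induction j, hj using Nat.le_induction with
    | base => rw [h1]; norm_num; linarith [log_two_lt_d9]
    | succ j hj ih =>
      have hle : log 2 ≤ log (w j) := log_le_log two_pos ih.1
      rw [hrec j hj]
      push_cast
      constructor <;> linarith
  have hw : Tendsto w atTop atTop := by
    refine tendsto_atTop_mono' atTop ?_ (tendsto_natCast_atTop_atTop.atTop_mul_const hlog2)
    filter_upwards [eventually_ge_atTop 1] with j hj using (hlower j hj).2
  refine tendsto_div_mul_log_of_tendsto_div_log hw ?_
  have hstep : Tendsto (fun j => w (j + 1) / log (w (j + 1)) - w j / log (w j))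
      atTop (nhds 1) := by
    have hM : Tendsto (fun j => log (w (j + 1))) atTop atTop :=
      tendsto_log_atTop.comp (hw.comp (tendsto_add_atTop_nat 1))
    have hl := (hM.const_div_atTop 2).const_sub 1
    rw [sub_zero] at hl
    refine tendsto_of_tendsto_of_tendsto_of_le_of_le' hl tendsto_const_nhds ?_ ?_
    all_goals
      filter_upwards [eventually_ge_atTop 1] with j hj
      have hb := div_log_step_bounds (a := w j) (by linarith [(hlower j hj).1])
      rw [← hrec j hj] at hb
    · exact hb.1
    · exact hb.2
  have hsum := hstep.cesaro.add
    (tendsto_natCast_atTop_atTop.const_div_atTop (w 0 / log (w 0)))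
  rw [add_zero] at hsum
  refine hsum.congr fun n => ?_
  rw [Finset.sum_range_sub (fun j => w j / log (w j))]
  ring
end

section
/- Let β : (ℤ₊)^d → (0,∞) be nondecreasing with (d log log |n|)^{1/2} ≤ β(n) ≤ (3d log log |n|)^{1/2} for all n with |n| ≥ e^e, set c(t) = β(⌊exp(t)⌋), and suppose J_{ε'} = Σ_{n ∈ F_{ε'}} |n|^{-1} β(n)^{2d−1} e^{−β(n)²/2} = ∞ for some ε' > 0. Let w_1 = 2, w_{j+1} = w_j + log w_j, and for k ∈ (ℤ₊)^d let I^{(k)} = ∏_{i=1}^d [w_{k_i}, w_{k_i+1}) and w_k = (w_{k_1}, …, w_{k_d}). Then for every 0 < ε < ε', Σ_{k ≥ (3,…,3), I^{(k)} ⊂ G_ε} v(I^{(k)}) c(w_k)^{2d−1} e^{−c(w_k)²/2} = ∞, where G_ε = {t : t_i / Σ_j t_j ≥ ε for all i} and v denotes d-dimensional Lebesgue volume. -/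
open Filter Real

lemma summable_of_sum_fiber_le {α κ : Type*} {g : α → ℝ} {h : κ → ℝ} (φ : α → κ) {C : ℝ}
    (hC : 0 ≤ C) (hg : ∀ a, 0 ≤ g a) (hh : ∀ k, 0 ≤ h k) (hs : Summable h)
    (hfib : ∀ (s : Finset α) (k : κ), (∀ a ∈ s, φ a = k) → ∑ a ∈ s, g a ≤ C * h k) :
    Summable g := by
  classical
  refine summable_of_sum_le (c := C * ∑' k, h k) hg fun s => ?_
  rw [← Finset.sum_fiberwise_of_maps_to (t := s.image φ) (g := φ)
    (fun a ha => Finset.mem_image_of_mem φ ha)]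
  calc ∑ k ∈ s.image φ, ∑ a ∈ s with φ a = k, g a
      ≤ ∑ k ∈ s.image φ, C * h k :=
        Finset.sum_le_sum fun k _ => hfib _ k fun a ha => (Finset.mem_filter.mp ha).2
    _ = C * ∑ k ∈ s.image φ, h k := by rw [Finset.mul_sum]
    _ ≤ C * ∑' k, h k :=
        mul_le_mul_of_nonneg_left (hs.sum_le_tsum _ fun k _ => hh k) hC

lemma pow_mul_exp_neg_sq_antitone {p : ℕ} {x y : ℝ} (hx : 0 < x) (hp : (p : ℝ) ≤ x ^ 2)
    (hxy : x ≤ y) : y ^ p * exp (-y ^ 2 / 2) ≤ x ^ p * exp (-x ^ 2 / 2) := by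
  have hr : 1 ≤ y / x := (one_le_div hx).mpr hxy
  have hyr : y = x * (y / x) := by field_simp
  set r := y / x
  have h1 : r ≤ exp ((r ^ 2 - 1) / 2) := by
    have := add_one_le_exp (r - 1)
    refine le_trans (by linarith) (exp_le_exp.mpr (?_ : r - 1 ≤ _))
    nlinarith [sq_nonneg (r - 1)]
  have h2 : r ^ p ≤ exp (p * ((r ^ 2 - 1) / 2)) := by
    rw [exp_nat_mul]
    exact pow_le_pow_left₀ (by linarith) h1 p
  have h3 : exp (p * ((r ^ 2 - 1) / 2)) ≤ exp (x ^ 2 * ((r ^ 2 - 1) / 2)) := by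
    apply exp_le_exp.mpr
    apply mul_le_mul_of_nonneg_right hp
    nlinarith
  calc y ^ p * exp (-y ^ 2 / 2) = x ^ p * (r ^ p * exp (-y ^ 2 / 2)) := by
        rw [← mul_assoc, ← mul_pow, ← hyr]
    _ ≤ x ^ p * (exp (x ^ 2 * ((r ^ 2 - 1) / 2)) * exp (-y ^ 2 / 2)) := by
        have := h2.trans h3
        gcongr
    _ = x ^ p * exp (-x ^ 2 / 2) := by
        rw [← exp_add]
        congr 2
        rw [hyr]
        ring

lemma sum_Ico_inv_le_log {a b : ℕ} (ha : 2 ≤ a) (hab : a ≤ b) :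
    ∑ m ∈ Finset.Ico a b, (m : ℝ)⁻¹ ≤ log ((b : ℝ) - 1) - log ((a : ℝ) - 1) := by
  induction b, hab using Nat.le_induction with
  | base => simp
  | succ b hab ih =>
    rw [Finset.sum_Ico_succ_top hab]
    have hb : (2 : ℝ) ≤ b := by exact_mod_cast ha.trans hab
    have h := one_sub_inv_le_log_of_pos (x := (b : ℝ) / (b - 1))
      (div_pos (by linarith) (by linarith))
    rw [log_div (by linarith) (by linarith)] at h
    have h' : 1 - ((b : ℝ) / (b - 1))⁻¹ = (b : ℝ)⁻¹ := by
      field_simp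
      ring
    rw [h'] at h
    push_cast
    rw [add_sub_cancel_right]
    linarith

lemma sum_Ico_ceil_exp_inv_le {x y : ℝ} (hx : log 2 ≤ x) (hxy : x ≤ y) :
    ∑ m ∈ Finset.Ico ⌈exp x⌉₊ ⌈exp y⌉₊, (m : ℝ)⁻¹ ≤ y - x + log 2 := by
  have h2 : (2 : ℝ) ≤ exp x := by
    rw [← exp_log (show (0 : ℝ) < 2 by norm_num)]
    exact exp_le_exp.mpr hx
  have ha : (2 : ℕ) ≤ ⌈exp x⌉₊ := by
    have : (2 : ℝ) ≤ ⌈exp x⌉₊ := h2.trans (Nat.le_ceil _)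
    exact_mod_cast this
  have hab : ⌈exp x⌉₊ ≤ ⌈exp y⌉₊ := Nat.ceil_mono (exp_le_exp.mpr hxy)
  refine (sum_Ico_inv_le_log ha hab).trans ?_
  have hbR : (2 : ℝ) ≤ ⌈exp y⌉₊ := by exact_mod_cast ha.trans hab
  have hb : log ((⌈exp y⌉₊ : ℝ) - 1) ≤ y := by
    rw [log_le_iff_le_exp (by linarith)]
    linarith [Nat.ceil_lt_add_one (exp_pos y).le]
  have hc : x - log 2 ≤ log ((⌈exp x⌉₊ : ℝ) - 1) := by
    rw [le_log_iff_exp_le (by linarith [Nat.le_ceil (exp x)]), exp_sub,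
      exp_log (by norm_num)]
    linarith [Nat.le_ceil (exp x)]
  linarith

lemma sum_prod_inv_le_prod_sum {ι : Type*} [Fintype ι] (s : Finset (ι → ℕ))
    (B : ι → Finset ℕ) (hs : ∀ n ∈ s, ∀ i, n i ∈ B i) :
    ∑ n ∈ s, (∏ i, (n i : ℝ))⁻¹ ≤ ∏ i, ∑ m ∈ B i, (m : ℝ)⁻¹ := by
  classical
  rw [Finset.prod_univ_sum]
  simp_rw [← Finset.prod_inv_distrib]
  refine Finset.sum_le_sum_of_subset_of_nonneg (fun n hn => Fintype.mem_piFinset.mpr (hs n hn)) ?_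
  intro n _ _
  positivity

lemma two_add_mul_log_two_le {w : ℕ → ℝ} (hw1 : w 1 = 2)
    (hwrec : ∀ j : ℕ, 1 ≤ j → w (j + 1) = w j + log (w j)) (j : ℕ) : 2 + j * log 2 ≤ w (j + 1) := by
  induction j with
  | zero => simp [hw1]
  | succ j ih =>
    rw [hwrec (j + 1) (by omega)]
    have h2 : 0 < log 2 := log_pos (by norm_num)
    have hj : 0 ≤ j * log 2 := by positivity
    have : log 2 ≤ log (w (j + 1)) := log_le_log (by norm_num) (by linarith)
    push_cast
    linarith

lemma two_le_of_log_recurrence {w : ℕ → ℝ} (hw1 : w 1 = 2)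
    (hwrec : ∀ j : ℕ, 1 ≤ j → w (j + 1) = w j + log (w j)) {j : ℕ} (hj : 1 ≤ j) : 2 ≤ w j := by
  obtain ⟨j, rfl⟩ := Nat.exists_eq_add_of_le' hj
  have h2 : 0 < log 2 := log_pos (by norm_num)
  have hj : 0 ≤ j * log 2 := by positivity
  linarith [two_add_mul_log_two_le hw1 hwrec j]

lemma log_two_le_sub_of_log_recurrence {w : ℕ → ℝ} (hw1 : w 1 = 2)
    (hwrec : ∀ j : ℕ, 1 ≤ j → w (j + 1) = w j + log (w j)) {j : ℕ} (hj : 1 ≤ j) : log 2 ≤ w (j + 1) - w j := by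
  rw [hwrec j hj, add_sub_cancel_left]
  exact log_le_log (by norm_num) (two_le_of_log_recurrence hw1 hwrec hj)

lemma exists_mem_Ico_of_log_recurrence {w : ℕ → ℝ} (hw1 : w 1 = 2)
    (hwrec : ∀ j : ℕ, 1 ≤ j → w (j + 1) = w j + log (w j)) {x : ℝ} (hx : 2 ≤ x) :
    ∃ j, 1 ≤ j ∧ w j ≤ x ∧ x < w (j + 1) := by
  classical
  have hex : ∃ j, x < w (j + 1) := by
    have h2 : 0 < log 2 := log_pos (by norm_num)
    obtain ⟨j, hj⟩ := exists_nat_gt (x / log 2)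
    rw [div_lt_iff₀ h2] at hj
    exact ⟨j, by linarith [two_add_mul_log_two_le hw1 hwrec j]⟩
  have h0 : Nat.find hex ≠ 0 := by
    intro h0
    have := Nat.find_spec hex
    rw [h0, zero_add, hw1] at this
    linarith
  obtain ⟨j, hj⟩ := Nat.exists_eq_succ_of_ne_zero h0
  refine ⟨Nat.find hex, by omega, ?_, Nat.find_spec hex⟩
  have := Nat.find_min hex (m := j) (by omega)
  rw [hj]
  exact not_lt.mp this

lemma three_le_of_lt_of_log_recurrence {w : ℕ → ℝ} (hw1 : w 1 = 2)
    (hwrec : ∀ j : ℕ, 1 ≤ j → w (j + 1) = w j + log (w j)) {x : ℝ} {j : ℕ} (hj : 1 ≤ j) (hx : w 3 ≤ x)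
    (hxj : x < w (j + 1)) : 3 ≤ j := by
  by_contra hlt
  have h2 : 0 < log 2 := log_pos (by norm_num)
  have h := log_two_le_sub_of_log_recurrence hw1 hwrec (j := 2) (by norm_num)
  norm_num at h
  have : j = 1 ∨ j = 2 := by omega
  rcases this with rfl | rfl <;> norm_num at hxj <;> linarith

lemma le_div_sum_of_relative_perturbation {ι : Type*} [Fintype ι] {a s t : ι → ℝ}
    {ε ε' q : ℝ} (hε : 0 < ε) (hq : 0 < q) (hqε : q ^ 2 * ε = ε')
    (ha : ∀ i, 0 < a i) (has : ∀ i, a i ≤ s i) (hsa : ∀ i, s i ≤ q * a i)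
    (hat : ∀ i, a i ≤ t i) (hta : ∀ i, t i ≤ q * a i)
    (hs : ∀ i, ε' * ∑ j, s j ≤ s i) (i : ι) : ε ≤ t i / ∑ j, t j := by
  have htpos : 0 < ∑ j, t j :=
    Finset.sum_pos (fun j _ => (ha j).trans_le (hat j)) ⟨i, Finset.mem_univ i⟩
  rw [le_div_iff₀ htpos]
  have h1 : ∑ j, t j ≤ q * ∑ j, s j := by
    rw [Finset.mul_sum]
    exact Finset.sum_le_sum fun j _ => (hta j).trans (mul_le_mul_of_nonneg_left (has j) hq.le)
  refine le_of_mul_le_mul_left ?_ hq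
  calc q * (ε * ∑ j, t j) = q * ε * ∑ j, t j := by ring
    _ ≤ q * ε * (q * ∑ j, s j) := mul_le_mul_of_nonneg_left h1 (by positivity)
    _ = ε' * ∑ j, s j := by rw [← hqε]; ring
    _ ≤ s i := hs i
    _ ≤ q * a i := hsa i
    _ ≤ q * t i := mul_le_mul_of_nonneg_left (hat i) hq.le

lemma mul_sum_log_le_of_le_log_div {ι : Type*} [Fintype ι] {n : ι → ℕ} {ε' : ℝ}
    (hε' : 0 < ε') (hn : 1 ≤ n)
    (h : ∀ i, ε' ≤ log (n i : ℝ) / log (∏ j, (n j : ℝ))) (i : ι) :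
    ε' * ∑ j, log (n j : ℝ) ≤ log (n i : ℝ) := by
  have hlog : log (∏ j, (n j : ℝ)) = ∑ j, log (n j : ℝ) :=
    log_prod fun j _ => by have : 1 ≤ n j := hn j; positivity
  have hnn : 0 ≤ ∑ j, log (n j : ℝ) := Finset.sum_nonneg fun j _ => log_natCast_nonneg _
  have hi := h i
  rw [hlog] at hi
  rcases hnn.eq_or_lt with h0 | hp
  · rw [← h0, div_zero] at hi
    linarith
  · exact (le_div_iff₀ hp).mp hi

lemma two_mul_le_sq_of_sqrt_loglog_le {d : ℕ} (hd : 1 ≤ d) {β : (Fin d → ℕ) → ℝ}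
    (hlow : ∀ n : Fin d → ℕ, (1 : Fin d → ℕ) ≤ n →
      exp (exp 1) ≤ ∏ i, (n i : ℝ) → √(d * log (log (∏ i, (n i : ℝ)))) ≤ β n)
    {m : Fin d → ℕ} (hm : ∀ i, exp (exp 2) ≤ m i) : 2 * (d : ℝ) ≤ β m ^ 2 := by
  have hE : (1 : ℝ) ≤ exp (exp 2) := one_le_exp (exp_pos _).le
  have hm1 : (1 : Fin d → ℕ) ≤ m := fun i => by
    have := hE.trans (hm i)
    exact_mod_cast this
  have hprod : exp (exp 2) ≤ ∏ i, (m i : ℝ) := by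
    calc exp (exp 2) ≤ exp (exp 2) ^ d := le_self_pow₀ hE (by omega)
      _ = ∏ _i : Fin d, exp (exp 2) := by simp
      _ ≤ ∏ i, (m i : ℝ) := Finset.prod_le_prod (fun _ _ => (exp_pos _).le) fun i _ => hm i
  have hb := hlow m hm1 ((exp_le_exp.mpr (exp_le_exp.mpr one_le_two)).trans hprod)
  have hll : 2 ≤ log (log (∏ i, (m i : ℝ))) := by
    have h1 : exp 2 ≤ log (∏ i, (m i : ℝ)) :=
      (le_log_iff_exp_le ((exp_pos _).trans_le hprod)).mpr hprod
    exact (le_log_iff_exp_le ((exp_pos _).trans_le h1)).mpr h1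
  have h := (sqrt_le_left ((sqrt_nonneg _).trans hb)).mp hb
  have : (d : ℝ) * 2 ≤ d * log (log (∏ i, (m i : ℝ))) :=
    mul_le_mul_of_nonneg_left hll (Nat.cast_nonneg d)
  linarith

/-- Lemma 3.8(ii): if `β` is nondecreasing with
`(d log log|n|)^{1/2} ≤ β(n) ≤ (3d log log|n|)^{1/2}` for `|n| ≥ e^e`, and
`J_{ε'} = ∞` for some `ε' > 0`, then for every `0 < ε < ε'`,
`Σ_{k ≥ 3, I^{(k)} ⊆ G_ε} v(I^{(k)}) c(w_k)^{2d-1} e^{-c(w_k)²/2} = ∞`,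
where `w 1 = 2`, `w (j+1) = w j + log w j`, `I^{(k)} = ∏_i [w_{k_i}, w_{k_i+1})`,
`c(t) = β(⌊exp t⌋)` and `G_ε = {t : t_i / Σ_j t_j ≥ ε for all i}`. -/
theorem divergence_over_rectangles
    (d : ℕ) (hd : 1 ≤ d)
    (β : (Fin d → ℕ) → ℝ)
    (hpos : ∀ n : Fin d → ℕ, (1 : Fin d → ℕ) ≤ n → 0 < β n)
    (hmono : ∀ m n : Fin d → ℕ, (1 : Fin d → ℕ) ≤ m → m ≤ n → β m ≤ β n)
    (hlow : ∀ n : Fin d → ℕ, (1 : Fin d → ℕ) ≤ n →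
      Real.exp (Real.exp 1) ≤ ∏ i, (n i : ℝ) →
      Real.sqrt (d * Real.log (Real.log (∏ i, (n i : ℝ)))) ≤ β n)
    (hupp : ∀ n : Fin d → ℕ, (1 : Fin d → ℕ) ≤ n →
      Real.exp (Real.exp 1) ≤ ∏ i, (n i : ℝ) →
      β n ≤ Real.sqrt (3 * d * Real.log (Real.log (∏ i, (n i : ℝ)))))
    (w : ℕ → ℝ) (hw1 : w 1 = 2)
    (hwrec : ∀ j : ℕ, 1 ≤ j → w (j + 1) = w j + Real.log (w j))
    (ε' : ℝ) (hε' : 0 < ε')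
    (hJ : ¬ Summable (fun n : {n : Fin d → ℕ //
        (1 : Fin d → ℕ) ≤ n ∧
          ∀ i, ε' ≤ Real.log (n i : ℝ) / Real.log (∏ j, (n j : ℝ))} =>
      (∏ i, (n.1 i : ℝ))⁻¹ * β n.1 ^ (2 * d - 1) * Real.exp (-(β n.1) ^ 2 / 2)))
    (ε : ℝ) (hε : 0 < ε) (hεε' : ε < ε') :
    ¬ Summable (fun k : {k : Fin d → ℕ //
        (∀ i, 3 ≤ k i) ∧
          {t : Fin d → ℝ | ∀ i, w (k i) ≤ t i ∧ t i < w (k i + 1)} ⊆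
            {t : Fin d → ℝ | ∀ i, ε ≤ t i / ∑ j, t j}} =>
      (∏ i, (w (k.1 i + 1) - w (k.1 i))) *
        (β fun i => ⌊Real.exp (w (k.1 i))⌋₊) ^ (2 * d - 1) *
          Real.exp (-(β fun i => ⌊Real.exp (w (k.1 i))⌋₊) ^ 2 / 2)) := by
  intro hsum
  apply hJ
  have hq : 1 < √(ε' / ε) := by
    rw [lt_sqrt (by norm_num), one_pow, one_lt_div hε]
    exact hεε'
  have hqε : √(ε' / ε) ^ 2 * ε = ε' := by
    rw [sq_sqrt (by positivity)]
    field_simp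
  set q := √(ε' / ε)
  obtain ⟨W, hW⟩ : ∃ W, ∀ x, W ≤ x → 0 ≤ x → log x ≤ (q - 1) * x := by
    obtain ⟨W, hW⟩ := eventually_atTop.mp
      (isLittleO_log_id_atTop.bound (show 0 < q - 1 by linarith))
    refine ⟨W, fun x hx hx0 => (le_abs_self _).trans ?_⟩
    simpa [abs_of_nonneg hx0] using hW x hx
  obtain ⟨R, hR3, hRW, hRE⟩ : ∃ R, w 3 ≤ R ∧ 2 * W ≤ R ∧ 2 * exp (exp 2) ≤ R :=
    ⟨max (w 3) (max (2 * W) (2 * exp (exp 2))), le_max_left _ _,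
      (le_max_left _ _).trans (le_max_right _ _), (le_max_right _ _).trans (le_max_right _ _)⟩
  have hR2 : 2 ≤ R := by linarith [one_le_exp (exp_pos 2).le]
  set S := {n : Fin d → ℕ | (1 : Fin d → ℕ) ≤ n ∧
    ∀ i, ε' ≤ log (n i : ℝ) / log (∏ j, (n j : ℝ))}
  set g : (Fin d → ℕ) → ℝ := fun n =>
    (∏ i, (n i : ℝ))⁻¹ * β n ^ (2 * d - 1) * exp (-(β n) ^ 2 / 2) with hg
  set A := {n : Fin d → ℕ | n ∈ S ∧ ∀ i, R ≤ log (n i : ℝ)}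
  have hfin : (S \ A).Finite := by
    refine (Set.finite_Iic (fun _ : Fin d => ⌈exp (R / ε')⌉₊)).subset ?_
    rintro n ⟨hnS, hnA⟩ j
    by_contra hj
    refine hnA ⟨hnS, fun i => le_trans ?_ (mul_sum_log_le_of_le_log_div hε' hnS.1 hnS.2 i)⟩
    have hj' : exp (R / ε') ≤ n j := by
      have : (⌈exp (R / ε')⌉₊ : ℝ) ≤ n j := by exact_mod_cast (not_le.mp hj).le
      exact (Nat.le_ceil _).trans this
    have h1 : R / ε' ≤ log (n j : ℝ) :=
      (le_log_iff_exp_le ((exp_pos _).trans_le hj')).mpr hj'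
    have h2 : log (n j : ℝ) ≤ ∑ j, log (n j : ℝ) :=
      Finset.single_le_sum (f := fun j => log (n j : ℝ))
        (fun j _ => log_natCast_nonneg _) (Finset.mem_univ j)
    rw [mul_comm]
    exact (div_le_iff₀ hε').mp (h1.trans h2)
  suffices hAsum : Summable fun n : A => g n by
    have hind : Summable (A.indicator g) := summable_subtype_iff_indicator.mp hAsum
    have hind' : Summable ((S \ A).indicator g) :=
      summable_subtype_iff_indicator.mp (hfin.summable g)
    change Summable (g ∘ ((↑) : S → Fin d → ℕ))
    rw [summable_subtype_iff_indicator]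
    have hAS : A ⊆ S := fun n hn => hn.1
    convert hind.add hind' using 1
    conv_lhs => rw [← Set.union_sdiff_cancel hAS]
    exact Set.indicator_union_of_disjoint Set.disjoint_sdiff_right g
  have hblock : ∀ n : A, ∃ k : Fin d → ℕ,
      ∀ i, 1 ≤ k i ∧ w (k i) ≤ log (n.1 i : ℝ) ∧ log (n.1 i : ℝ) < w (k i + 1) := by
    intro n
    choose k hk using fun i => exists_mem_Ico_of_log_recurrence hw1 hwrec
      (hR2.trans (n.2.2 i))
    exact ⟨k, hk⟩
  choose k hk using hblock
  have hk3 : ∀ n i, 3 ≤ k n i := fun n i =>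
    three_le_of_lt_of_log_recurrence hw1 hwrec (hk n i).1 (hR3.trans (n.2.2 i)) (hk n i).2.2
  have hwk : ∀ n i, R ≤ 2 * w (k n i) := by
    intro n i
    have h1 := (n.2.2 i).trans (hk n i).2.2.le
    have h2 := two_le_of_log_recurrence hw1 hwrec (hk n i).1
    rw [hwrec _ (hk n i).1] at h1
    linarith [log_le_sub_one_of_pos (show 0 < w (k n i) by linarith)]
  have hwq : ∀ n i, w (k n i + 1) ≤ q * w (k n i) := by
    intro n i
    have h2 := two_le_of_log_recurrence hw1 hwrec (hk n i).1
    rw [hwrec _ (hk n i).1]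
    linarith [hW (w (k n i)) (by linarith [hwk n i]) (by linarith)]
  have hcone : ∀ n, {t : Fin d → ℝ | ∀ i, w (k n i) ≤ t i ∧ t i < w (k n i + 1)} ⊆
      {t : Fin d → ℝ | ∀ i, ε ≤ t i / ∑ j, t j} := fun n t ht i =>
    le_div_sum_of_relative_perturbation (a := fun i => w (k n i))
      (s := fun i => log (n.1 i : ℝ)) hε (zero_lt_one.trans hq) hqε
      (fun i => two_pos.trans_le (two_le_of_log_recurrence hw1 hwrec (hk n i).1))
      (fun i => (hk n i).2.1) (fun i => (hk n i).2.2.le.trans (hwq n i))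
      (fun i => (ht i).1) (fun i => (ht i).2.le.trans (hwq n i))
      (mul_sum_log_le_of_le_log_div hε' n.2.1.1 n.2.1.2) i
  have hfloor : ∀ j : Fin d → ℕ, (∀ i, 3 ≤ j i) →
      (1 : Fin d → ℕ) ≤ fun i => ⌊exp (w (j i))⌋₊ := by
    intro j hj i
    have := two_le_of_log_recurrence hw1 hwrec (show 1 ≤ j i by linarith [hj i])
    exact Nat.one_le_floor_iff _ |>.mpr (one_le_exp (by linarith))
  have hterm : ∀ n : A, β n.1 ^ (2 * d - 1) * exp (-(β n.1) ^ 2 / 2) ≤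
      (β fun i => ⌊exp (w (k n i))⌋₊) ^ (2 * d - 1) *
        exp (-(β fun i => ⌊exp (w (k n i))⌋₊) ^ 2 / 2) := by
    intro n
    have hm1 := hfloor (k n) (hk3 n)
    refine pow_mul_exp_neg_sq_antitone (hpos _ hm1) ?_ (hmono _ _ hm1 fun i => ?_)
    · have hcast : ((2 * d - 1 : ℕ) : ℝ) ≤ 2 * d := by
        exact_mod_cast Nat.sub_le (2 * d) 1
      refine hcast.trans (two_mul_le_sq_of_sqrt_loglog_le hd hlow fun i => ?_)
      linarith [Nat.lt_floor_add_one (exp (w (k n i))), add_one_le_exp (w (k n i)), hwk n i]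
    · have hn1 : 1 ≤ n.1 i := n.2.1.1 i
      have : exp (w (k n i)) ≤ n.1 i :=
        (le_log_iff_exp_le (by positivity)).mp (hk n i).2.1
      exact Nat.floor_le_of_le this
  have hdiff : ∀ j : ℕ, 3 ≤ j → log 2 ≤ w (j + 1) - w j := fun j hj =>
    log_two_le_sub_of_log_recurrence hw1 hwrec (by omega)
  have hlog2 : 0 < log 2 := log_pos (by norm_num)
  refine summable_of_sum_fiber_le (fun n : A => ⟨k n, hk3 n, hcone n⟩) (C := 2 ^ d)
    (by positivity) (fun n => ?_) (fun j => ?_) hsum fun s j hsj => ?_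
  · have := hpos n.1 n.2.1.1
    positivity
  · have := hpos _ (hfloor j.1 j.2.1)
    have : 0 ≤ ∏ i, (w (j.1 i + 1) - w (j.1 i)) :=
      Finset.prod_nonneg fun i _ => hlog2.le.trans (hdiff _ (j.2.1 i))
    positivity
  have hkj : ∀ n ∈ s, k n = j.1 := fun n hn => congrArg Subtype.val (hsj n hn)
  set c := (β fun i => ⌊exp (w (j.1 i))⌋₊) ^ (2 * d - 1) *
    exp (-(β fun i => ⌊exp (w (j.1 i))⌋₊) ^ 2 / 2) with hc
  have hc0 : 0 ≤ c := by
    have := hpos _ (hfloor j.1 j.2.1)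
    positivity
  have hmass : ∑ n ∈ s, (∏ i, (n.1 i : ℝ))⁻¹ ≤
      2 ^ d * ∏ i, (w (j.1 i + 1) - w (j.1 i)) := by
    calc ∑ n ∈ s, (∏ i, (n.1 i : ℝ))⁻¹
        = ∑ n ∈ s.map (Function.Embedding.subtype _), (∏ i, (n i : ℝ))⁻¹ := by
          rw [Finset.sum_map]
          rfl
      _ ≤ ∏ i, ∑ m ∈ Finset.Ico ⌈exp (w (j.1 i))⌉₊ ⌈exp (w (j.1 i + 1))⌉₊, (m : ℝ)⁻¹ := by
          refine sum_prod_inv_le_prod_sum _ _ fun n hn i => ?_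
          obtain ⟨n, hns, rfl⟩ := Finset.mem_map.mp hn
          have hn1 : 1 ≤ n.1 i := n.2.1.1 i
          have hn0 : (0 : ℝ) < n.1 i := by positivity
          have h := (hk n i).2
          rw [hkj n hns] at h
          exact Finset.mem_Ico.mpr ⟨Nat.ceil_le.mpr ((le_log_iff_exp_le hn0).mp h.1),
            Nat.lt_ceil.mpr ((log_lt_iff_lt_exp hn0).mp h.2)⟩
      _ ≤ ∏ i, (2 * (w (j.1 i + 1) - w (j.1 i))) := by
          refine Finset.prod_le_prod
            (fun i _ => Finset.sum_nonneg fun m _ => by positivity) fun i _ => ?_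
          have h1 := hdiff _ (j.2.1 i)
          have h2 := two_le_of_log_recurrence hw1 hwrec (show 1 ≤ j.1 i by linarith [j.2.1 i])
          have h3 : log 2 ≤ 1 := by linarith [log_le_sub_one_of_pos two_pos]
          linarith [sum_Ico_ceil_exp_inv_le (x := w (j.1 i)) (y := w (j.1 i + 1))
            (by linarith) (by linarith)]
      _ = 2 ^ d * ∏ i, (w (j.1 i + 1) - w (j.1 i)) := by
          simp [Finset.prod_mul_distrib]
  calc ∑ n ∈ s, g n.1 ≤ ∑ n ∈ s, (∏ i, (n.1 i : ℝ))⁻¹ * c := by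
        refine Finset.sum_le_sum fun n hn => ?_
        have h := hterm n
        rw [hkj n hn] at h
        simp only [hg, mul_assoc]
        exact mul_le_mul_of_nonneg_left h (by positivity)
    _ = (∑ n ∈ s, (∏ i, (n.1 i : ℝ))⁻¹) * c := by rw [Finset.sum_mul]
    _ ≤ 2 ^ d * (∏ i, (w (j.1 i + 1) - w (j.1 i))) * c :=
        mul_le_mul_of_nonneg_right hmass hc0
    _ = _ := by rw [hc]; ring
end
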